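/- Let d ≥ 1 and let x ∈ ℝ^d have all coordinates nonzero. Then ∫_{(0,∞)^d} ∫_{(0,∞)^d} [∏_{j=1}^d 1{−s_j ≤ x_j ≤ t_j}] · exp(−∑_{j=1}^d (t_j + s_j)) / ∏_{j=1}^d (t_j + s_j) dt ds = exp(−‖x‖₁) ∏_{j=1}^d h(|x_j|), where h(r) := 1 − r e^{r} E₁(r) and ‖·‖₁ is the ℓ¹ norm. Equivalently, if {T_{j,0}, T_{j,1}}_{j=1,…,d} are 2d i.i.d. rate-1 exponential random variables and Z₀ := ∏_{j=1}^d [−T_{j,0}, T_{j,1}], then E[1{x ∈ Z₀} / Vol(Z₀)] = e^{−‖x‖₁} ∏_{j=1}^d h(|x_j|). -/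

import Mathlib

open MeasureTheory
open scoped Classical

/-- The exponential integral `E₁(r) = ∫_r^∞ e^{-s}/s ds`. -/
noncomputable def E1 (r : ℝ) : ℝ := ∫ s in Set.Ioi r, Real.exp (-s) / s

/-- `h(r) = 1 - r e^r E₁(r)`, the volume-correction factor of the Mondrian
forest kernel. -/
noncomputable def hker (r : ℝ) : ℝ := 1 - r * Real.exp r * E1 r

open Set in
theorem integrableOn_exp_neg_div_Ioi {a : ℝ} (ha : 0 < a) :
    IntegrableOn (fun s : ℝ => Real.exp (-s) / s) (Ioi a) := by
  refine Integrable.mono' ((integrableOn_exp_neg_Ioi a).div_const a)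
    (by fun_prop : Measurable fun s : ℝ => Real.exp (-s) / s).aestronglyMeasurable ?_
  filter_upwards [ae_restrict_mem measurableSet_Ioi] with s hs
  have hs' : a < s := hs
  rw [Real.norm_of_nonneg (div_nonneg (Real.exp_pos _).le (ha.trans hs').le)]
  gcongr

theorem E1_nonneg {r : ℝ} (hr : 0 ≤ r) : 0 ≤ E1 r :=
  setIntegral_nonneg measurableSet_Ioi fun _ hs =>
    div_nonneg (Real.exp_pos _).le (hr.trans (le_of_lt hs))

theorem mul_E1_le_exp_neg {r : ℝ} (hr : 0 < r) : r * E1 r ≤ Real.exp (-r) := by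
  rw [E1, ← integral_exp_neg_Ioi r, ← integral_const_mul]
  refine setIntegral_mono_on ((integrableOn_exp_neg_div_Ioi hr).const_mul r)
    (integrableOn_exp_neg_Ioi r) measurableSet_Ioi fun s hs => ?_
  have hs' : r < s := hs
  have hs0 : 0 < s := hr.trans hs'
  rw [mul_div_assoc', div_le_iff₀ hs0, mul_comm]
  gcongr

open Set in
theorem hasDerivAt_E1 {r : ℝ} (hr : 0 < r) : HasDerivAt E1 (-(Real.exp (-r) / r)) r := by
  have hcont : ContinuousOn (fun s : ℝ => Real.exp (-s) / s) (Ioi 0) :=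
    ContinuousOn.div (by fun_prop) continuousOn_id fun s hs => ne_of_gt hs
  have hderiv : HasDerivAt (fun u => ∫ s in r..u, Real.exp (-s) / s) (Real.exp (-r) / r) r :=
    intervalIntegral.integral_hasDerivAt_right (by simp)
      (hcont.stronglyMeasurableAtFilter isOpen_Ioi r hr)
      (hcont.continuousAt (Ioi_mem_nhds hr))
  refine (hderiv.const_sub (E1 r)).congr_of_eventuallyEq ?_
  filter_upwards [Ioi_mem_nhds hr] with u hu
  have := intervalIntegral.integral_Ioi_sub_Ioi' (integrableOn_exp_neg_div_Ioi hr)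
    (integrableOn_exp_neg_div_Ioi hu)
  simp only [E1]
  linarith

open Set Filter Topology in
theorem integral_E1_Ioi {r : ℝ} (hr : 0 < r) :
    ∫ u in Ioi r, E1 u = Real.exp (-r) * hker r := by
  have hderiv : ∀ u ∈ Ici r, HasDerivAt (fun u => u * E1 u - Real.exp (-u)) (E1 u) u := by
    intro u hu
    have hu0 : 0 < u := hr.trans_le hu
    have h := ((hasDerivAt_id u).mul (hasDerivAt_E1 hu0)).sub (hasDerivAt_neg u).exp
    refine h.congr_deriv ?_
    simp only [id]
    field_simp
    ring
  have hexp : Tendsto (fun u : ℝ => Real.exp (-u)) atTop (𝓝 0) :=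
    Real.tendsto_exp_neg_atTop_nhds_zero
  have hmul : Tendsto (fun u : ℝ => u * E1 u) atTop (𝓝 0) := by
    refine squeeze_zero' ?_ ?_ hexp
    · filter_upwards [eventually_ge_atTop 0] with u hu using mul_nonneg hu (E1_nonneg hu)
    · filter_upwards [eventually_gt_atTop 0] with u hu using mul_E1_le_exp_neg hu
  rw [integral_Ioi_of_hasDerivAt_of_nonneg' hderiv
    (fun u hu => E1_nonneg (hr.trans hu).le) (by simpa using hmul.sub hexp), hker]
  have hmul_exp : Real.exp (-r) * Real.exp r = 1 := by
    rw [← Real.exp_add, neg_add_cancel, Real.exp_zero]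
  linear_combination (r * E1 r) * hmul_exp

open Set in
theorem integral_Ioi_comp_add_left (g : ℝ → ℝ) (a c : ℝ) :
    ∫ t in Ioi a, g (c + t) = ∫ u in Ioi (c + a), g u := by
  have h := (measurePreserving_add_left (volume : Measure ℝ) c).setIntegral_preimage_emb
    (measurableEmbedding_addLeft c) g (Ioi (c + a))
  simpa using h

open Set in
theorem integral_Ioi_ite_le (g : ℝ → ℝ) (a c : ℝ) :
    ∫ t in Ioi a, (if c ≤ t then g t else 0) = ∫ t in Ioi (max a c), g t := by
  have h : (fun t => if c ≤ t then g t else 0) = (Ici c).indicator g := by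
    ext t
    simp [indicator_apply]
  rw [h, setIntegral_indicator measurableSet_Ici, ← Ioi_inter_Ioi]
  exact setIntegral_congr_set ((ae_eq_refl _).inter Ioi_ae_eq_Ici.symm)

open Set in
theorem integral_mondrian_kernel_one_dim {x : ℝ} (hx : x ≠ 0) :
    ∫ s in Ioi (0 : ℝ), ∫ t in Ioi (0 : ℝ),
      (if -s ≤ x ∧ x ≤ t then Real.exp (-(t + s)) / (t + s) else 0)
      = Real.exp (-|x|) * hker |x| := by
  have hinner : ∀ s : ℝ, ∫ t in Ioi (0 : ℝ),
      (if -s ≤ x ∧ x ≤ t then Real.exp (-(t + s)) / (t + s) else 0)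
      = if -x ≤ s then E1 (max 0 x + s) else 0 := by
    intro s
    by_cases hs : -x ≤ s
    · simp only [neg_le.1 hs, true_and, hs, if_true]
      rw [integral_Ioi_ite_le (fun t => Real.exp (-(t + s)) / (t + s)), add_comm, E1,
        ← integral_Ioi_comp_add_left]
      simp only [add_comm]
    · simp [hs, mt neg_le.1 hs]
  have habs : max 0 x + max 0 (-x) = |x| := by
    rcases le_total 0 x with h | h
    · simp [h, abs_of_nonneg h]
    · simp [h, abs_of_nonpos h]
  simp only [hinner]
  rw [integral_Ioi_ite_le (fun s => E1 (max 0 x + s)), integral_Ioi_comp_add_left E1, habs,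
    integral_E1_Ioi (abs_pos.2 hx)]

theorem setIntegral_univ_pi_prod {ι : Type*} [Fintype ι] (S : ι → Set ℝ) (f : ι → ℝ → ℝ) :
    ∫ y in Set.univ.pi S, ∏ i, f i (y i) = ∏ i, ∫ y in S i, f i y := by
  rw [volume_pi, Measure.restrict_pi_pi, integral_fintype_prod_eq_prod]

/-- For `x ∈ ℝ^d` with all coordinates nonzero,
`∫_{(0,∞)^d} ∫_{(0,∞)^d} [∏ⱼ 1{-sⱼ ≤ xⱼ ≤ tⱼ}] e^{-∑ⱼ(tⱼ+sⱼ)} / ∏ⱼ(tⱼ+sⱼ) dt ds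
 = e^{-‖x‖₁} ∏ⱼ h(|xⱼ|)` with `h(r) = 1 - r e^r E₁(r)`.  Equivalently, if
`Z₀ = ∏ⱼ [-T_{j,0}, T_{j,1}]` with i.i.d. rate-1 exponentials `T_{j,k}`, then
`E[1{x ∈ Z₀}/Vol(Z₀)] = e^{-‖x‖₁} ∏ⱼ h(|xⱼ|)`. -/
theorem mondrian_zero_cell_kernel_eq
    {d : ℕ} (hd : 1 ≤ d) (x : Fin d → ℝ) (hx : ∀ j, x j ≠ 0) :
    (∫ s in Set.univ.pi (fun _ : Fin d => Set.Ioi (0 : ℝ)),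
      ∫ t in Set.univ.pi (fun _ : Fin d => Set.Ioi (0 : ℝ)),
        (if ∀ j, -s j ≤ x j ∧ x j ≤ t j then
          Real.exp (-(∑ j, (t j + s j))) / ∏ j, (t j + s j) else 0))
      = Real.exp (-(∑ j, |x j|)) * ∏ j, hker |x j| := by
  have hprod : ∀ s t : Fin d → ℝ,
      (if ∀ j, -s j ≤ x j ∧ x j ≤ t j then
        Real.exp (-(∑ j, (t j + s j))) / ∏ j, (t j + s j) else 0)
      = ∏ j, (if -s j ≤ x j ∧ x j ≤ t j then
        Real.exp (-(t j + s j)) / (t j + s j) else 0) := by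
    intro s t
    split_ifs with h
    · rw [Finset.prod_congr rfl fun j _ => if_pos (h j), Finset.prod_div_distrib,
        ← Real.exp_sum, Finset.sum_neg_distrib]
    · obtain ⟨j, hj⟩ := not_forall.1 h
      exact (Finset.prod_eq_zero (Finset.mem_univ j) (if_neg hj)).symm
  simp only [hprod]
  have hinner : ∀ s : Fin d → ℝ, _ := fun s =>
    setIntegral_univ_pi_prod (fun _ : Fin d => Set.Ioi (0 : ℝ)) fun j t =>
      if -s j ≤ x j ∧ x j ≤ t then Real.exp (-(t + s j)) / (t + s j) else 0
  simp only [hinner]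
  rw [setIntegral_univ_pi_prod (fun _ : Fin d => Set.Ioi (0 : ℝ)) fun j s =>
    ∫ t in Set.Ioi (0 : ℝ), if -s ≤ x j ∧ x j ≤ t then Real.exp (-(t + s)) / (t + s) else 0]
  simp only [fun j => integral_mondrian_kernel_one_dim (hx j)]
  rw [Finset.prod_mul_distrib, ← Real.exp_sum, Finset.sum_neg_distrib]
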